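/- Under the stated hypotheses, for every z ∈ (0,b) the function p ↦ p·v′(p)² is not integrable on (0,z); that is, ∫₀ᶻ p·v′(p)² dp = +∞, where v′(p) = −(1−b)/(2b·√(2r)·(1−p)²·φ(√(2r)·v(p))). -/

import Mathlib

/-- The standard normal density `φ(z) = exp(-z²/2)/√(2π)`. -/
noncomputable def npdf (z : ℝ) : ℝ := (Real.sqrt (2 * Real.pi))⁻¹ * Real.exp (-z ^ 2 / 2)

/-- The standard normal distribution function `Φ(y) = ∫_{-∞}^y φ(z) dz`. -/
noncomputable def ncdf (y : ℝ) : ℝ := ∫ z in Set.Iic y, npdf z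

/-- The standard normal tail function `Ψ(y) = 1 - Φ(y)`. -/
noncomputable def ntail (y : ℝ) : ℝ := 1 - ncdf y

/-- The function `F(y) = φ(y) - y·Ψ(y)`. -/
noncomputable def Fstat (y : ℝ) : ℝ := npdf y - y * ntail y

open Set Filter Topology MeasureTheory ProbabilityTheory in
lemma aux_nonneg {f f' : ℝ → ℝ} {a : ℝ} (hd : ∀ x, a ≤ x → HasDerivAt f (f' x) x)
    (hn : ∀ x, a ≤ x → f' x ≤ 0) (ht : Tendsto f atTop (𝓝 0)) {x : ℝ} (hx : a ≤ x) : 0 ≤ f x := by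
  have hanti : AntitoneOn f (Ici a) := by
    apply antitoneOn_of_deriv_nonpos (convex_Ici a)
    · exact fun y hy => (hd y hy).continuousAt.continuousWithinAt
    · exact fun y hy => (hd y (interior_subset hy)).differentiableAt.differentiableWithinAt
    · intro y hy
      rw [(hd y (interior_subset hy)).deriv]
      exact hn y (interior_subset hy)
  refine le_of_tendsto ht ?_
  filter_upwards [eventually_ge_atTop x] with y hy
  exact hanti hx (hx.trans hy) hy

lemma npdf_eq : npdf = ProbabilityTheory.gaussianPDFReal 0 1 := by
  funext x
  simp [npdf, ProbabilityTheory.gaussianPDFReal]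

lemma npdf_pos (x : ℝ) : 0 < npdf x := by
  unfold npdf; positivity

lemma npdf_hasDerivAt (x : ℝ) : HasDerivAt npdf (-x * npdf x) x := by
  have h : HasDerivAt (fun x : ℝ => -x ^ 2 / 2) (-x) x := by
    have := ((hasDerivAt_pow 2 x).neg).div_const 2
    refine this.congr_deriv ?_
    simp; ring
  have := (h.exp).const_mul ((Real.sqrt (2 * Real.pi))⁻¹)
  refine this.congr_deriv ?_
  unfold npdf; ring

lemma npdf_cont : Continuous npdf :=
  continuous_iff_continuousAt.2 fun x => (npdf_hasDerivAt x).continuousAt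

lemma npdf_integrable : MeasureTheory.Integrable npdf := by
  rw [npdf_eq]; exact ProbabilityTheory.integrable_gaussianPDFReal 0 1

open Set Filter Topology MeasureTheory ProbabilityTheory in
lemma ntail_tendsto : Tendsto ntail atTop (𝓝 0) := by
  have h := (aecover_Iic (μ := (volume : Measure ℝ)) (tendsto_id (α := ℝ) (x := atTop))).integral_tendsto_of_countably_generated
    npdf_integrable
  have h1 : ∫ x, npdf x = 1 := by
    rw [npdf_eq]; exact integral_gaussianPDFReal_eq_one 0 one_ne_zero
  rw [h1] at h
  have := h.const_sub 1
  rw [sub_self] at this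
  exact this

open Set Filter Topology MeasureTheory ProbabilityTheory in
lemma ntail_hasDerivAt (x : ℝ) : HasDerivAt ntail (-npdf x) x := by
  have e : ntail = fun y => (1 - ncdf 0) - ∫ t in (0:ℝ)..y, npdf t := by
    funext y
    rw [← intervalIntegral.integral_Iic_sub_Iic npdf_integrable.integrableOn
      npdf_integrable.integrableOn]
    simp only [ntail, ncdf]; ring
  rw [e]
  have := intervalIntegral.integral_hasDerivAt_right
    (npdf_cont.intervalIntegrable 0 x) (npdf_cont.stronglyMeasurableAtFilter _ _)
    npdf_cont.continuousAt
  exact this.const_sub _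

open Set Filter Topology in
lemma tendsto_exp_aux : Tendsto (fun y : ℝ => Real.exp (-y ^ 2 / 2)) atTop (𝓝 0) := by
  refine Real.tendsto_exp_atBot.comp ?_
  have : Tendsto (fun y : ℝ => y ^ 2 / 2) atTop atTop :=
    (tendsto_pow_atTop two_ne_zero).atTop_div_const two_pos
  refine (tendsto_neg_atTop_atBot.comp this).congr fun y => ?_
  simp; ring

lemma sqrt_two_pi_ge : 1 ≤ Real.sqrt (2 * Real.pi) := by
  rw [Real.one_le_sqrt]; linarith [Real.pi_gt_three]

open Set Filter Topology in
lemma npdf_tendsto : Tendsto npdf atTop (𝓝 0) := by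
  have := tendsto_exp_aux.const_mul ((Real.sqrt (2 * Real.pi))⁻¹)
  rw [mul_zero] at this
  exact this

lemma npdf_le_exp (x : ℝ) : npdf x ≤ Real.exp (-x ^ 2 / 2) := by
  unfold npdf
  have := inv_le_one_of_one_le₀ sqrt_two_pi_ge
  nlinarith [Real.exp_pos (-x ^ 2 / 2)]

lemma ntail_le_one (x : ℝ) : ntail x ≤ 1 := by
  have : 0 ≤ ncdf x := MeasureTheory.integral_nonneg fun y => (npdf_pos y).le
  unfold ntail; linarith

lemma ntail_le_npdf {x : ℝ} (hx : 1 ≤ x) : ntail x ≤ npdf x := by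
  have := aux_nonneg (f := fun y => npdf y - ntail y) (f' := fun y => -y * npdf y - -npdf y) (a := 1)
    (fun y _ => (npdf_hasDerivAt y).sub (ntail_hasDerivAt y))
    (fun y hy => by nlinarith [npdf_pos y])
    (by simpa using npdf_tendsto.sub ntail_tendsto) hx
  linarith

lemma ntail_le_exp {x : ℝ} (hx : 0 ≤ x) : ntail x ≤ 2 * Real.exp (-x ^ 2 / 2) := by
  rcases le_total 1 x with h | h
  · have := ntail_le_npdf h
    linarith [npdf_le_exp x, Real.exp_pos (-x ^ 2 / 2)]
  · have h1 := ntail_le_one x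
    have h2 := Real.add_one_le_exp (-x ^ 2 / 2)
    nlinarith

open Set Filter Topology in
lemma npdf_le_mul_ntail {x : ℝ} (hx : 0 ≤ x) : npdf x ≤ (1 + x) * ntail x := by
  have := aux_nonneg (f := fun y => ntail y - npdf y / (1 + y))
    (f' := fun y => -npdf y - (-y * npdf y * (1 + y) - npdf y * 1) / (1 + y) ^ 2) (a := 0)
    (fun y hy => (ntail_hasDerivAt y).sub ((npdf_hasDerivAt y).div
      ((hasDerivAt_id y).const_add 1) (by positivity)))
    (fun y hy => by
      have h1 : (0:ℝ) < 1 + y := by linarith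
      have : -npdf y - (-y * npdf y * (1 + y) - npdf y * 1) / (1 + y) ^ 2
        = - (npdf y * y / (1 + y) ^ 2) := by field_simp; ring
      rw [this]
      have := npdf_pos y
      have : 0 ≤ npdf y * y / (1 + y) ^ 2 := by positivity
      linarith)
    (by
      have h2 : Tendsto (fun y : ℝ => 1 + y) atTop atTop := tendsto_atTop_add_const_left _ _ tendsto_id
      simpa using ntail_tendsto.sub (npdf_tendsto.div_atTop h2)) hx
  have h1 : (0:ℝ) < 1 + x := by linarith
  have h3 : npdf x / (1 + x) ≤ ntail x := by linarith
  rw [div_le_iff₀ h1] at h3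
  linarith

open Set Filter Topology MeasureTheory Asymptotics in
lemma not_int_aux (A c z : ℝ) (hc : 0 < c) (hz : 0 < z) :
    ¬ IntegrableOn (fun p => c / (p * (A - 4 * Real.log p))) (Ioo 0 z) := by
  have hlim : Tendsto (fun p => A - 4 * Real.log p) (𝓝[>] 0) atTop := by
    have := (Real.tendsto_log_nhdsGT_zero.const_mul_atBot (show (0:ℝ) < 4 by norm_num))
    have := tendsto_atTop_add_const_left _ A (tendsto_neg_atBot_atTop.comp this)
    exact this.congr fun p => by simp; ring
  have hD : ∀ᶠ p in 𝓝[>] (0:ℝ), HasDerivAt (fun p => Real.log (A - 4 * Real.log p))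
      (-(4 * p⁻¹) / (A - 4 * Real.log p)) p := by
    filter_upwards [self_mem_nhdsWithin, hlim.eventually_gt_atTop 0] with p hp hp2
    exact (((Real.hasDerivAt_log (ne_of_gt hp)).const_mul 4).const_sub A).log hp2.ne'
  refine not_integrableOn_of_tendsto_norm_atTop_of_deriv_isBigO_filter (𝓝[>] (0:ℝ))
    (f := fun p => Real.log (A - 4 * Real.log p)) (Ioo_mem_nhdsGT hz)
    (hD.mono fun p h => h.differentiableAt)
    (tendsto_norm_atTop_atTop.comp (Real.tendsto_log_atTop.comp hlim)) ?_
  refine IsBigO.of_bound (4 / c) ?_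
  filter_upwards [hD] with p h
  rw [h.deriv]
  apply le_of_eq
  rw [← Real.norm_of_nonneg (show 0 ≤ 4 / c by positivity), ← norm_mul, ← norm_neg]
  congr 1
  field_simp

/-- for every z ∈ (0,b), the integral ∫₀ᶻ p·v′(p)² dp is infinite,
where v′(p) = −(1−b)/(2b√(2r)(1−p)²φ(√(2r)v(p))). -/
theorem integral_infinite (r b : ℝ) (v v' : ℝ → ℝ) (hr : 0 < r)
    (hb : b ∈ Set.Ioo (0:ℝ) 1)
    (hv : ∀ p ∈ Set.Ioo (0:ℝ) b, 0 < v p ∧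
      ntail (Real.sqrt (2*r) * v p) = (1 - b) * p / (2 * b * (1 - p)))
    (hv' : ∀ p ∈ Set.Ioo (0:ℝ) b, v' p =
      -(1 - b) / (2 * b * Real.sqrt (2*r) * (1 - p) ^ 2
        * npdf (Real.sqrt (2*r) * v p))) :
    ∀ z ∈ Set.Ioo (0:ℝ) b,
      ∫⁻ p in Set.Ioo (0:ℝ) z, ENNReal.ofReal (p * (v' p) ^ 2) = ⊤ := by
  obtain ⟨hb0, hb1⟩ := hb
  rintro z ⟨hz0, hzb⟩
  obtain ⟨k, hk⟩ : ∃ k, k = (1 - b) / (2 * b) := ⟨_, rfl⟩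
  have hk0 : 0 < k := by rw [hk]; apply div_pos <;> linarith
  obtain ⟨A, hA⟩ : ∃ A, A = 2 + 4 * Real.log (2 / k) := ⟨_, rfl⟩
  have key : ∀ p ∈ Set.Ioo (0:ℝ) z, 0 ≤ (1 / (2 * r)) / (p * (A - 4 * Real.log p)) ∧
      (1 / (2 * r)) / (p * (A - 4 * Real.log p)) ≤ p * (v' p) ^ 2 := by
    rintro p ⟨hp0, hpz⟩
    have hpb : p ∈ Set.Ioo (0:ℝ) b := ⟨hp0, hpz.trans hzb⟩
    obtain ⟨hvp, ht⟩ := hv p hpb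
    have hq : 0 < 1 - p := by linarith
    have hs : 0 < Real.sqrt (2 * r) := Real.sqrt_pos.2 (by linarith)
    have hs2 : Real.sqrt (2 * r) ^ 2 = 2 * r := Real.sq_sqrt (by linarith)
    have hvv := hv' p hpb
    obtain ⟨y, hy⟩ : ∃ y, y = Real.sqrt (2 * r) * v p := ⟨_, rfl⟩
    have hy0 : 0 < y := by rw [hy]; positivity
    rw [← hy] at ht hvv
    have ht' : ntail y = k * p / (1 - p) := by rw [ht, hk]; field_simp
    have hvv' : v' p = -k / (Real.sqrt (2 * r) * (1 - p) ^ 2 * npdf y) := by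
      rw [hvv, hk]
      have := npdf_pos y
      field_simp
    have hφ := npdf_pos y
    have hm := npdf_le_mul_ntail hy0.le
    have he := ntail_le_exp hy0.le
    have hle : k * p ≤ ntail y := by
      rw [ht', le_div_iff₀ hq]
      nlinarith [mul_pos hk0 hp0]
    have hlog : Real.log (k * p / 2) ≤ -y ^ 2 / 2 := by
      rw [Real.log_le_iff_le_exp (by positivity)]
      linarith
    have hlog2 : Real.log (k * p / 2) = Real.log p - Real.log (2 / k) := by
      rw [← Real.log_div hp0.ne' (by positivity)]
      congr 1
      field_simp
    have hB : (1 + y) ^ 2 ≤ A - 4 * Real.log p := by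
      rw [hA]; nlinarith [sq_nonneg (1 - y)]
    have hBpos : 0 < A - 4 * Real.log p := lt_of_lt_of_le (by positivity) hB
    refine ⟨by positivity, ?_⟩
    have hsq : p * (v' p) ^ 2 = p * k ^ 2 / (2 * r * (1 - p) ^ 4 * npdf y ^ 2) := by
      rw [hvv', div_pow, mul_pow, mul_pow, hs2]
      field_simp
    rw [hsq, div_div, div_le_div_iff₀ (by positivity) (by positivity)]
    have h1 : npdf y * (1 - p) ≤ (1 + y) * (k * p) := by
      have h2 : ntail y * (1 - p) = k * p := by rw [ht']; field_simp
      calc npdf y * (1 - p) ≤ (1 + y) * ntail y * (1 - p) := by gcongr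
        _ = _ := by rw [mul_assoc, h2]
    have h3 : (npdf y * (1 - p)) ^ 2 ≤ ((1 + y) * (k * p)) ^ 2 :=
      pow_le_pow_left₀ (by positivity) h1 2
    have h4 : ((1 + y) * (k * p)) ^ 2 ≤ (A - 4 * Real.log p) * (k * p) ^ 2 := by
      rw [mul_pow]; gcongr
    have h5 : (1 - p) ^ 2 ≤ 1 := by nlinarith
    have h6 : (npdf y * (1 - p)) ^ 2 * (1 - p) ^ 2 ≤ (A - 4 * Real.log p) * (k * p) ^ 2 := by
      exact (mul_le_of_le_one_right (by positivity) h5).trans (h3.trans h4)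
    calc 1 * (2 * r * (1 - p) ^ 4 * npdf y ^ 2)
        = 2 * r * ((npdf y * (1 - p)) ^ 2 * (1 - p) ^ 2) := by ring
      _ ≤ 2 * r * ((A - 4 * Real.log p) * (k * p) ^ 2) := by gcongr
      _ = _ := by ring
  have hni := not_int_aux A (1 / (2 * r)) z (by positivity) hz0
  rw [eq_top_iff]
  have hmeas : Measurable (fun p : ℝ => (1 / (2 * r)) / (p * (A - 4 * Real.log p))) := by fun_prop
  have htop : ∫⁻ p in Set.Ioo (0:ℝ) z,
      ENNReal.ofReal ((1 / (2 * r)) / (p * (A - 4 * Real.log p))) = ⊤ := by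
    by_contra hne
    apply hni
    refine (MeasureTheory.lintegral_ofReal_ne_top_iff_integrable
      hmeas.aestronglyMeasurable ?_).1 hne
    exact MeasureTheory.ae_restrict_of_forall_mem measurableSet_Ioo fun p hp => (key p hp).1
  rw [← htop]
  exact MeasureTheory.setLIntegral_mono' measurableSet_Ioo
    fun p hp => ENNReal.ofReal_le_ofReal (key p hp).2
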